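/- arXiv:1308.4341 — 2 statements merged into one kernel-verified Lean document; each statement's English description precedes it below -/
import Mathlib

section
/- Let k ≥ 1, n > 7k², and let G be a simple graph of order n. If q(G) ≥ q(S_{n,k}) and G contains no path on 2k+2 vertices as a subgraph, then G has a vertex of degree n−1 (i.e., Δ(G) = n−1). -/
open Matrix BigOperators

noncomputable def edgeCount {V : Type*} (G : SimpleGraph V) : ℕ := Nat.card G.edgeSet

noncomputable def deg {V : Type*} (G : SimpleGraph V) (v : V) : ℕ := Nat.card (G.neighborSet v)

def HasPathOn {V : Type*} (G : SimpleGraph V) (l : ℕ) : Prop :=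
  ∃ (u v : V) (p : G.Walk u v), p.IsPath ∧ p.support.length = l

noncomputable def signlessLaplacian {V : Type*} [Fintype V] [DecidableEq V]
    (G : SimpleGraph V) : Matrix V V ℝ :=
  letI : DecidableRel G.Adj := Classical.decRel _
  Matrix.diagonal (fun v => (deg G v : ℝ)) + G.adjMatrix ℝ

theorem signlessLaplacian_isHermitian {V : Type*} [Fintype V] [DecidableEq V]
    (G : SimpleGraph V) : (signlessLaplacian G).IsHermitian := by
  letI : DecidableRel G.Adj := Classical.decRel _
  unfold signlessLaplacian
  refine (Matrix.isHermitian_diagonal _).add ?_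
  rw [Matrix.IsHermitian, Matrix.conjTranspose_eq_transpose_of_trivial]
  exact G.isSymm_adjMatrix

/-- The `Q`-index of a graph: the largest eigenvalue of its signless Laplacian. -/
noncomputable def qIndex {V : Type*} [Fintype V] [DecidableEq V] (G : SimpleGraph V) : ℝ :=
  ⨆ v, (signlessLaplacian_isHermitian G).eigenvalues v

noncomputable def adjMat {V : Type*} [Fintype V] (G : SimpleGraph V) : Matrix V V ℝ :=
  letI : DecidableRel G.Adj := Classical.decRel _
  G.adjMatrix ℝ

theorem adjMat_isHermitian {V : Type*} [Fintype V] (G : SimpleGraph V) :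
    (adjMat G).IsHermitian := by
  letI : DecidableRel G.Adj := Classical.decRel _
  unfold adjMat
  rw [Matrix.IsHermitian, Matrix.conjTranspose_eq_transpose_of_trivial]
  exact G.isSymm_adjMatrix

/-- The spectral radius `μ`: the largest eigenvalue of the adjacency matrix. -/
noncomputable def muIndex {V : Type*} [Fintype V] [DecidableEq V] (G : SimpleGraph V) : ℝ :=
  ⨆ v, (adjMat_isHermitian G).eigenvalues v

/-- `S_{n,k} = K_k ∨ \overline{K_{n-k}}`: the first `k` vertices form a clique joined to all. -/
def Snk (n k : ℕ) : SimpleGraph (Fin n) :=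
  SimpleGraph.fromRel (fun i j => (i : ℕ) < k ∨ (j : ℕ) < k)

/-- `S_{n,k}^+`: `S_{n,k}` plus one edge inside the independent set. -/
def SnkPlus (n k : ℕ) : SimpleGraph (Fin n) :=
  SimpleGraph.fromRel (fun i j => (i : ℕ) < k ∨ (j : ℕ) < k ∨ ((i : ℕ) = k ∧ (j : ℕ) = k + 1))

/-- `L_{t,k} = K_1 ∨ tK_k`: `t` cliques of order `k+1` sharing a common center `none`. -/
def LGraph (t k : ℕ) : SimpleGraph (Option (Fin t × Fin k)) :=
  SimpleGraph.fromRel (fun x y => x = none ∨ ∃ i a b, x = some (i, a) ∧ y = some (i, b))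

/-- `K_1 ∨ (sK_k ∪ K_m)`. -/
def K1JoinCliques (s k m : ℕ) : SimpleGraph (Option ((Fin s × Fin k) ⊕ Fin m)) :=
  SimpleGraph.fromRel (fun x y => x = none ∨
    (∃ i a b, x = some (Sum.inl (i, a)) ∧ y = some (Sum.inl (i, b))) ∨
    (∃ a b, x = some (Sum.inr a) ∧ y = some (Sum.inr b)))

/-- Two disjoint copies of `L_{s,k}` and `L_{t,k}` with their centers joined by an edge. -/
def DoubleL (s t k : ℕ) : SimpleGraph (Option (Fin s × Fin k) ⊕ Option (Fin t × Fin k)) :=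
  SimpleGraph.fromRel (fun x y =>
    (∃ a b, x = Sum.inl a ∧ y = Sum.inl b ∧ (LGraph s k).Adj a b) ∨
    (∃ a b, x = Sum.inr a ∧ y = Sum.inr b ∧ (LGraph t k).Adj a b) ∨
    (x = Sum.inl none ∧ y = Sum.inr none))

/-- `G` is (a copy of) a subgraph of `H`. -/
def IsSubgraphOf {V W : Type*} (G : SimpleGraph V) (H : SimpleGraph W) : Prop :=
  ∃ f : V ↪ W, ∀ a b, G.Adj a b → H.Adj (f a) (f b)

/-- `G` contains `m` pairwise disjoint edges. -/
def HasMatching {V : Type*} (G : SimpleGraph V) (m : ℕ) : Prop :=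
  ∃ M : Finset (Sym2 V), M.card = m ∧ (∀ e ∈ M, e ∈ G.edgeSet) ∧
    ∀ e ∈ M, ∀ f ∈ M, e ≠ f → ∀ v : V, ¬(v ∈ e ∧ v ∈ f)

/-- `G` is 2-connected: at least 3 vertices, and deleting any vertex leaves a connected graph. -/
def TwoConnected {V : Type*} [Fintype V] (G : SimpleGraph V) : Prop :=
  3 ≤ Fintype.card V ∧ ∀ v : V, (G.induce {w : V | w ≠ v}).Connected

/-- The vertices of `l`, in this order, form a path of `H` inside `S`. -/
def IsPathList {V : Type*} (H : SimpleGraph V) (S : Finset V) (l : List V) : Prop :=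
  l.Nodup ∧ l.IsChain H.Adj ∧ ∀ x ∈ l, x ∈ S

namespace IsPathList

variable {V : Type*} {H : SimpleGraph V} {S T : Finset V} {l l₁ l₂ : List V}

theorem mono (h : IsPathList H S l) (hST : S ⊆ T) : IsPathList H T l :=
  ⟨h.1, h.2.1, fun x hx => hST (h.2.2 x hx)⟩

theorem reverse (h : IsPathList H S l) : IsPathList H S l.reverse := by
  refine ⟨List.nodup_reverse.2 h.1, ?_, fun x hx => h.2.2 x (List.mem_reverse.1 hx)⟩
  rw [List.isChain_reverse]
  exact h.2.1.imp fun a b hab => hab.symm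

theorem append (h₁ : IsPathList H S l₁) (h₂ : IsPathList H S l₂) (hd : ∀ x ∈ l₁, x ∉ l₂)
    (hadj : ∀ x ∈ l₁.getLast?, ∀ y ∈ l₂.head?, H.Adj x y) : IsPathList H S (l₁ ++ l₂) := by
  refine ⟨List.nodup_append.2 ⟨h₁.1, h₂.1, ?_⟩, List.isChain_append.2 ⟨h₁.2.1, h₂.2.1, hadj⟩, ?_⟩
  · rintro a ha b hb rfl
    exact hd a ha hb
  · intro x hx
    rcases List.mem_append.1 hx with hx | hx
    · exact h₁.2.2 x hx
    · exact h₂.2.2 x hx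

theorem singleton {x : V} (hx : x ∈ S) : IsPathList H S [x] :=
  ⟨List.nodup_singleton x, List.isChain_singleton x, by simpa using hx⟩

theorem cons {a b : V} (h : IsPathList H S l) (hb : l.head? = some b) (ha : a ∈ S) (hal : a ∉ l)
    (hab : H.Adj a b) : IsPathList H S (a :: l) := by
  refine (singleton ha).append h (by simpa using hal) ?_
  simp only [List.getLast?_singleton, Option.mem_def, Option.some.injEq]
  rintro x rfl y hy
  rw [hb, Option.some.injEq] at hy
  exact hy ▸ hab

theorem left (h : IsPathList H S (l₁ ++ l₂)) : IsPathList H S l₁ :=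
  ⟨(List.nodup_append.1 h.1).1, (List.isChain_append.1 h.2.1).1,
    fun x hx => h.2.2 x (List.mem_append_left _ hx)⟩

theorem right (h : IsPathList H S (l₁ ++ l₂)) : IsPathList H S l₂ :=
  ⟨(List.nodup_append.1 h.1).2.1, (List.isChain_append.1 h.2.1).2.1,
    fun x hx => h.2.2 x (List.mem_append_right _ hx)⟩

theorem disjoint (h : IsPathList H S (l₁ ++ l₂)) : ∀ x ∈ l₁, x ∉ l₂ :=
  fun x h₁ h₂ => (List.nodup_append.1 h.1).2.2 x h₁ x h₂ rfl

theorem insert {x y w : V} (h : IsPathList H S (l₁ ++ x :: y :: l₂)) (hw : w ∈ S)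
    (hwl : w ∉ l₁ ++ x :: y :: l₂) (hx : H.Adj w x) (hy : H.Adj w y) :
    IsPathList H S (l₁ ++ x :: w :: y :: l₂) := by
  have e : l₁ ++ x :: y :: l₂ = (l₁ ++ [x]) ++ (y :: l₂) := by simp
  have e' : l₁ ++ x :: w :: y :: l₂ = (l₁ ++ [x]) ++ (w :: y :: l₂) := by simp
  rw [e] at h hwl
  rw [e']
  refine h.left.append (h.right.cons rfl hw (fun hm => hwl (List.mem_append_right _ hm)) hy) ?_ ?_
  · intro z hz hz'
    rcases List.mem_cons.1 hz' with rfl | hz'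
    · exact hwl (List.mem_append_left _ hz)
    · exact h.disjoint z hz hz'
  · simpa using hx.symm

/-- A closed path list can be rotated so as to start at any of its vertices. -/
theorem exists_rotation {c : V} (h : IsPathList H S l)
    (hcl : ∀ x ∈ l.getLast?, ∀ y ∈ l.head?, H.Adj x y) (hc : c ∈ l) :
    ∃ t, IsPathList H S (c :: t) ∧ (c :: t).Perm l := by
  obtain ⟨s, t, rfl⟩ := List.append_of_mem hc
  refine ⟨t ++ s, ?_, ?_⟩
  · have : IsPathList H S ((c :: t) ++ s) := by
      refine h.right.append h.left (fun x hx hx' => h.disjoint x hx' hx) ?_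
      intro x hx y hy
      refine hcl x ?_ y ?_
      · rw [List.getLast?_append]; simp [Option.mem_def.1 hx]
      · rw [List.head?_append]; simp [Option.mem_def.1 hy]
    simpa using this
  · simpa using (List.perm_append_comm (l₁ := c :: t) (l₂ := s))

end IsPathList

theorem List.two_mul_countP_le_or_exists_consecutive {α : Type*} (p : α → Prop) [DecidablePred p] :
    ∀ l : List α, 2 * l.countP p ≤ l.length + (if ∃ x ∈ l.head?, p x then 1 else 0) ∨
      ∃ l₁ x y l₂, l = l₁ ++ x :: y :: l₂ ∧ p x ∧ p y
  | [] => by simp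
  | x :: t => by
    rcases List.two_mul_countP_le_or_exists_consecutive p t with h | ⟨l₁, a, b, l₂, rfl, ha, hb⟩
    · by_cases hx : p x
      · cases t with
        | nil => left; simp [hx]
        | cons y t' =>
          by_cases hy : p y
          · exact Or.inr ⟨[], x, y, t', rfl, hx, hy⟩
          · left
            simp [hx, hy] at h ⊢
            omega
      · left
        simp only [List.countP_cons, hx, decide_false, List.length_cons]
        simp [hx]
        split_ifs at h <;> omega
    · exact Or.inr ⟨x :: l₁, a, b, l₂, rfl, ha, hb⟩

section ClosedSet

/-- A bound for paths with both ends in `A` gives one for all paths, if every edge meets `A`. -/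
theorem IsPathList.length_le_of_ends {V : Type*} [DecidableEq V] {H : SimpleGraph V}
    {A S : Finset V} {p : ℕ} (hA : ∀ x y, H.Adj x y → x ∈ A ∨ y ∈ A)
    (hp : ∀ l a b, IsPathList H S l → l.head? = some a → l.getLast? = some b → a ∈ A → b ∈ A →
      l.length ≤ p) (l : List V) (a b : V) (hl : IsPathList H S l) (ha : l.head? = some a)
    (hb : l.getLast? = some b) :
    l.length ≤ p + (if a ∈ A then 0 else 1) + (if b ∈ A then 0 else 1) := by
  have key : ∀ l a b, IsPathList H S l → l.head? = some a → l.getLast? = some b → b ∈ A →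
      l.length ≤ p + (if a ∈ A then 0 else 1) := by
    intro l a b hl ha hb hbA
    split_ifs with haA
    · exact hp l a b hl ha hb haA hbA
    · cases l with
      | nil => simp
      | cons x t =>
        cases t with
        | nil => simp
        | cons y t =>
          have hxa : x = a := by simpa using ha
          subst hxa
          have hxy : H.Adj x y := (List.isChain_cons_cons.1 hl.2.1).1
          have := hp (y :: t) y b (IsPathList.right (l₁ := [x]) hl) rfl (by simpa using hb)
            ((hA _ _ hxy).resolve_left haA) hbA
          simp at this ⊢
          omega
  by_cases hbA : b ∈ A
  · simpa [hbA] using key l a b hl ha hb hbA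
  · obtain ⟨t, rfl⟩ : ∃ t, l = t ++ [b] := by
      have hne : l ≠ [] := by rintro rfl; simp at ha
      refine ⟨l.dropLast, ?_⟩
      rw [List.getLast?_eq_some_getLast hne, Option.some.injEq] at hb
      rw [← hb, List.dropLast_append_getLast hne]
    rcases List.eq_nil_or_concat t with rfl | ⟨s, c, rfl⟩
    · simp [hbA]
    · have hcb : H.Adj c b := by
        have := (List.isChain_append.1 hl.2.1).2.2 c (by simp) b (by simp)
        exact this
      have := key (s.concat c) a c hl.left ?_ (by simp) ((hA _ _ hcb).resolve_right hbA)
      · simp [hbA] at this ⊢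
        omega
      · cases s <;> simpa using ha

variable {V : Type*} [DecidableEq V] (H : SimpleGraph V) [DecidableRel H.Adj] (A S : Finset V)

theorem card_neighbors_le_countP {v : V} {l : List V}
    (h : ∀ x ∈ S, H.Adj v x → x ∈ l) :
    (S.filter (H.Adj v)).card ≤ l.countP (H.Adj v) := by
  rw [List.countP_eq_length_filter]
  refine le_trans (Finset.card_le_card (t := (l.filter (H.Adj v)).toFinset) ?_)
    (List.toFinset_card_le _)
  intro x hx
  rw [Finset.mem_filter] at hx
  simp [h x hx.1 hx.2, hx.2]

variable {H A S}

/-- Crossing chords at the two ends of a path give a cycle on its vertex set. -/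
theorem IsPathList.exists_cycle {P : List V} {v z : V} (hP : IsPathList H S P)
    (hv : P.head? = some v) (hz : P.getLast? = some z) (hvP : ∀ w ∈ S, H.Adj v w → w ∈ P)
    (hzP : ∀ w ∈ S, H.Adj z w → w ∈ P)
    (hdeg : P.length ≤ (S.filter (H.Adj v)).card + (S.filter (H.Adj z)).card) :
    ∃ C, IsPathList H S C ∧ (∀ x ∈ C.getLast?, ∀ y ∈ C.head?, H.Adj x y) ∧ C.Perm P := by
  have hne : P ≠ [] := by rintro rfl; simp at hv
  have hpos : 0 < P.length := List.length_pos_iff.2 hne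
  have hv0 : P[0] = v := by
    rw [List.head?_eq_getElem?, List.getElem?_eq_getElem hpos] at hv
    simpa using hv
  have hzl : P[P.length - 1] = z := by
    rw [List.getLast?_eq_getElem?, List.getElem?_eq_getElem (by omega)] at hz
    simpa using hz
  have hidx : ∀ w ∈ S, H.Adj v w → 1 ≤ P.idxOf w := by
    intro w hw hvw
    by_contra hcon
    have h0 : P.idxOf w = 0 := by omega
    have := List.getElem_idxOf (List.idxOf_lt_length_iff.2 (hvP w hw hvw))
    simp only [h0, hv0] at this
    exact hvw.ne this
  set I := (S.filter (H.Adj v)).image (fun w => P.idxOf w - 1) with hI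
  set J := (S.filter (H.Adj z)).image (fun w => P.idxOf w) with hJ
  have hIc : I.card = (S.filter (H.Adj v)).card := by
    refine Finset.card_image_of_injOn ?_
    intro a ha b hb hab
    simp only [Finset.coe_filter, Set.mem_ofPred_eq] at ha hb
    have h1 := hidx a ha.1 ha.2
    have h2 := hidx b hb.1 hb.2
    simp only at hab
    exact (List.idxOf_inj (hvP a ha.1 ha.2)).1 (by omega)
  have hJc : J.card = (S.filter (H.Adj z)).card := by
    refine Finset.card_image_of_injOn ?_
    intro a ha b hb hab
    simp only [Finset.coe_filter, Set.mem_ofPred_eq] at ha hb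
    exact (List.idxOf_inj (hzP a ha.1 ha.2)).1 hab
  have hIJ : I ∪ J ⊆ Finset.range (P.length - 1) := by
    intro i hi
    rw [Finset.mem_range]
    rcases Finset.mem_union.1 hi with hi | hi
    · obtain ⟨w, hw, rfl⟩ := Finset.mem_image.1 hi
      rw [Finset.mem_filter] at hw
      have h1 := List.idxOf_lt_length_iff.2 (hvP w hw.1 hw.2)
      have h2 := hidx w hw.1 hw.2
      omega
    · obtain ⟨w, hw, rfl⟩ := Finset.mem_image.1 hi
      rw [Finset.mem_filter] at hw
      have h1 := List.idxOf_lt_length_iff.2 (hzP w hw.1 hw.2)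
      by_contra hcon
      have h0 : P.idxOf w = P.length - 1 := by omega
      have := List.getElem_idxOf h1
      simp only [h0, hzl] at this
      exact hw.2.ne this
  obtain ⟨i, hiI, hiJ⟩ : ∃ i, i ∈ I ∧ i ∈ J := by
    by_contra! hcon
    have := Finset.card_le_card hIJ
    rw [Finset.card_union_of_disjoint (Finset.disjoint_left.2 hcon), hIc, hJc,
      Finset.card_range] at this
    omega
  obtain ⟨x, hx, hxi⟩ := Finset.mem_image.1 hiI
  obtain ⟨y, hy, hyi⟩ := Finset.mem_image.1 hiJ
  rw [Finset.mem_filter] at hx hy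
  have hxl := List.idxOf_lt_length_iff.2 (hvP x hx.1 hx.2)
  have hyl := List.idxOf_lt_length_iff.2 (hzP y hy.1 hy.2)
  have hx1 := hidx x hx.1 hx.2
  have hPx : P[i + 1]? = some x := by
    rw [← List.getElem_idxOf hxl, List.getElem?_eq_getElem (by omega)]
    congr 2
    omega
  have hPy : P[i]? = some y := by
    rw [← List.getElem_idxOf hyl, List.getElem?_eq_getElem (by omega)]
    congr 2
    omega
  have hsplit : IsPathList H S (P.take (i + 1) ++ P.drop (i + 1)) := by
    rwa [List.take_append_drop]
  have hlast : (P.take (i + 1)).getLast? = some y := by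
    rw [List.getLast?_take]
    simp [hPy]
  have hhead : (P.drop (i + 1)).head? = some x := by
    rw [List.head?_drop, hPx]
  have hlast' : (P.drop (i + 1)).getLast? = some z := by
    rw [List.getLast?_drop, if_neg (by omega), hz]
  have hhead' : (P.take (i + 1)).head? = some v := by
    rw [List.head?_take, if_neg (by omega), hv]
  refine ⟨P.take (i + 1) ++ (P.drop (i + 1)).reverse, ?_, ?_, ?_⟩
  · refine hsplit.left.append hsplit.right.reverse ?_ ?_
    · intro w hw hw'
      exact hsplit.disjoint w hw (List.mem_reverse.1 hw')
    · rw [hlast, List.head?_reverse, hlast']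
      rintro _ ⟨⟩ _ ⟨⟩
      exact hy.2.symm
  · rw [List.getLast?_append, List.getLast?_reverse, hhead, List.head?_append, hhead']
    rintro _ ⟨⟩ _ ⟨⟩
    exact hx.2.symm
  · calc P.take (i + 1) ++ (P.drop (i + 1)).reverse
        |>.Perm (P.take (i + 1) ++ P.drop (i + 1)) :=
          (List.Perm.refl _).append (List.reverse_perm _)
      _ = P := List.take_append_drop _ _

theorem exists_closed_subset {k : ℕ} (hA : ∀ x y, H.Adj x y → x ∈ A ∨ y ∈ A)
    (hS : ∀ l a b, IsPathList H S l → l.head? = some a → l.getLast? = some b → a ∈ A → b ∈ A →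
      l.length < 2 * k)
    (hdA : ∀ a ∈ S, k ≤ (S.filter (H.Adj a)).card)
    (hdB : ∀ b ∈ S, b ∉ A → k + 1 ≤ (S.filter (H.Adj b)).card)
    (hne : (S ∩ A).Nonempty) :
    ∃ R ⊆ S, R.Nonempty ∧ R.card < 2 * k ∧ ∀ x ∈ R, ∀ y ∈ S, H.Adj x y → y ∈ R := by
  obtain ⟨P, v, z, hP, hv, hz, hvA, hzA, hmax⟩ : ∃ P a b, IsPathList H S P ∧ P.head? = some a ∧
      P.getLast? = some b ∧ a ∈ A ∧ b ∈ A ∧ ∀ l a b, IsPathList H S l → l.head? = some a →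
        l.getLast? = some b → a ∈ A → b ∈ A → l.length ≤ P.length := by
    let s : Set ℕ := {m | ∃ l a b, IsPathList H S l ∧ l.head? = some a ∧
      l.getLast? = some b ∧ a ∈ A ∧ b ∈ A ∧ l.length = m}
    have hbdd : BddAbove s := by
      refine ⟨2 * k, ?_⟩
      rintro m ⟨l, a, b, hl, ha, hb, haA, hbA, rfl⟩
      exact (hS l a b hl ha hb haA hbA).le
    have hsne : s.Nonempty := by
      obtain ⟨x, hx⟩ := hne
      rw [Finset.mem_inter] at hx
      exact ⟨1, [x], x, x, IsPathList.singleton hx.1, rfl, rfl, hx.2, hx.2, rfl⟩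
    obtain ⟨l, a, b, hl, ha, hb, haA, hbA, hlen⟩ := Nat.sSup_mem hsne hbdd
    refine ⟨l, a, b, hl, ha, hb, haA, hbA, ?_⟩
    intro l' a' b' hl' ha' hb' haA' hbA'
    rw [hlen]
    exact le_csSup hbdd ⟨l', a', b', hl', ha', hb', haA', hbA', rfl⟩
  have hlt : P.length < 2 * k := hS P v z hP hv hz hvA hzA
  have hgen := IsPathList.length_le_of_ends hA hmax
  have hvS : v ∈ S := hP.2.2 v (List.mem_of_head? hv)
  have hzS : z ∈ S := hP.2.2 z (List.mem_of_getLast? hz)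
  -- a vertex outside of the path has a neighbor outside of the path
  have hX : ∀ w ∈ S, w ∉ P → ∃ y ∈ S, H.Adj w y ∧ y ∉ P := by
    intro w hw hwP
    by_contra! hcon
    have hcount := card_neighbors_le_countP H S hcon
    have hins : ¬ ∃ l₁ x y l₂, P = l₁ ++ x :: y :: l₂ ∧ H.Adj w x ∧ H.Adj w y := by
      rintro ⟨l₁, x, y, l₂, hPe, hx, hy⟩
      have h1 := (hPe ▸ hP).insert hw (hPe ▸ hwP) hx hy
      have h2 := hmax _ v z h1 (by rw [hPe] at hv; cases l₁ <;> simpa using hv)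
        (by rw [hPe] at hz; simpa [List.getLast?_append, List.getLast?_cons] using hz) hvA hzA
      rw [hPe] at h2
      simp at h2
    have hc := (List.two_mul_countP_le_or_exists_consecutive (H.Adj w) P).resolve_right hins
    by_cases hwA : w ∈ A
    · have hnv : ¬ H.Adj w v := by
        intro hadj
        have := hmax (w :: P) w z (hP.cons hv hw hwP hadj) rfl (by simp [List.getLast?_cons, hz])
          hwA hzA
        simp at this
      rw [if_neg (by simpa [hv] using hnv)] at hc
      have := hdA w hw
      omega
    · have := hdB w hw hwA
      split_ifs at hc <;> omega
  -- the neighbors of the ends of a longest path lie on it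
  have hY : ∀ Q a b, IsPathList H S Q → Q.head? = some a → Q.getLast? = some b → b ∈ A →
      Q.Perm P → ∀ w ∈ S, H.Adj a w → w ∈ P := by
    intro Q a b hQ ha hb hbA hQP w hw haw
    by_contra hwP
    obtain ⟨y, hyS, hwy, hyP⟩ := hX w hw hwP
    have h1 := hQ.cons ha hw (fun h => hwP (hQP.mem_iff.1 h)) haw.symm
    have h2 := h1.cons rfl hyS (by
      rw [List.mem_cons, not_or]
      exact ⟨hwy.ne', fun h => hyP (hQP.mem_iff.1 h)⟩) hwy.symm
    have l1 := hgen _ w b h1 rfl (by simp [List.getLast?_cons, hb])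
    have l2 := hgen _ y b h2 rfl (by simp [List.getLast?_cons, hb])
    have hlen := hQP.length_eq
    have := hA _ _ hwy
    simp only [List.length_cons, hbA, if_true] at l1 l2
    split_ifs at l1 l2 <;> omega
  have hYv := hY P v z hP hv hz hzA (List.Perm.refl _)
  have hYz := hY P.reverse z v hP.reverse (by simpa using hz) (by simpa using hv) hvA
    (List.reverse_perm _)
  -- crossing chords give a cycle on the vertex set of the path
  obtain ⟨C, hC, hcl, hCP⟩ := hP.exists_cycle hv hz hYv hYz
    (by have := hdA v hvS; have := hdA z hzS; omega)
  have hlenC := hCP.length_eq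
  -- no edge leaves the cycle
  have hclosed : ∀ c ∈ P, ∀ w ∈ S, H.Adj c w → w ∈ P := by
    have hrot : ∀ c ∈ P, ∃ t, IsPathList H S (c :: t) ∧ (c :: t).Perm P := fun c hc => by
      obtain ⟨t, ht, hp⟩ := hC.exists_rotation hcl (hCP.mem_iff.2 hc)
      exact ⟨t, ht, hp.trans hCP⟩
    -- a path of two outside vertices attached to the cycle
    have htwo : ∀ c ∈ P, ∀ w ∈ S, w ∉ P → H.Adj c w → ∀ a ∈ S, a ∉ P → H.Adj w a → a ∉ A := by
      intro c hc w hw hwP hcw a ha haP hwa haA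
      obtain ⟨t, ht, hp⟩ := hrot c hc
      have h1 := ht.cons rfl hw (fun h => hwP (hp.mem_iff.1 h)) hcw.symm
      have h2 := h1.cons rfl ha (by
        rw [List.mem_cons, not_or]
        exact ⟨hwa.ne', fun h => haP (hp.mem_iff.1 h)⟩) hwa.symm
      have := hgen _ a _ h2 rfl (List.getLast?_eq_some_getLast (by simp))
      have hlen := hp.length_eq
      simp only [List.length_cons, haA, if_true] at this hlen
      split_ifs at this <;> omega
    intro c hc w hw hcw
    by_contra hwP
    obtain ⟨a, haS, hwa, haP⟩ := hX w hw hwP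
    have haA := htwo c hc w hw hwP hcw a haS haP hwa
    have hwA : w ∈ A := (hA _ _ hwa).resolve_right haA
    obtain ⟨a', ha', hne'⟩ : ∃ a' ∈ S.filter (H.Adj a), a' ≠ w := by
      refine Finset.exists_mem_ne ?_ w
      have := hdB a haS haA
      omega
    rw [Finset.mem_filter] at ha'
    by_cases haP' : a' ∈ P
    · exact htwo a' haP' a haS haP ha'.2.symm w hw hwP hwa.symm hwA
    · have haA' : a' ∈ A := (hA _ _ ha'.2).resolve_left haA
      obtain ⟨t, ht, hp⟩ := hrot c hc
      have h1 := ht.cons rfl hw (fun h => hwP (hp.mem_iff.1 h)) hcw.symm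
      have h2 := h1.cons rfl haS (by
        rw [List.mem_cons, not_or]
        exact ⟨hwa.ne', fun h => haP (hp.mem_iff.1 h)⟩) hwa.symm
      have h3 := h2.cons rfl ha'.1 (by
        rw [List.mem_cons, List.mem_cons, not_or, not_or]
        exact ⟨ha'.2.ne', hne', fun h => haP' (hp.mem_iff.1 h)⟩) ha'.2.symm
      have := hgen _ a' _ h3 rfl (List.getLast?_eq_some_getLast (by simp))
      have hlen := hp.length_eq
      simp only [List.length_cons, haA', if_true] at this hlen
      split_ifs at this <;> omega
  refine ⟨P.toFinset, ?_, ⟨v, ?_⟩, ?_, ?_⟩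
  · intro x hx
    exact hP.2.2 x (List.mem_toFinset.1 hx)
  · exact List.mem_toFinset.2 (List.mem_of_head? hv)
  · exact (List.toFinset_card_le P).trans_lt hlt
  · intro x hx y hy hxy
    rw [List.mem_toFinset] at hx ⊢
    exact hclosed x hx y hy hxy

theorem sum_card_filter_erase {v : V} (hv : v ∈ S) (T : Finset V) :
    ∑ a ∈ T, (S.filter (H.Adj a)).card =
      ∑ a ∈ T, ((S.erase v).filter (H.Adj a)).card + (T.filter (H.Adj v)).card := by
  rw [Finset.card_filter, ← Finset.sum_add_distrib]
  refine Finset.sum_congr rfl fun a _ => ?_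
  rw [Finset.filter_erase]
  split_ifs with h
  · exact (Finset.card_erase_add_one (Finset.mem_filter.2 ⟨hv, h.symm⟩)).symm
  · rw [Finset.erase_eq_of_notMem (by simp [H.adj_comm a v, h]), add_zero]

/-- If every edge meets `A` and no path with both ends in `A` has `2k` or more vertices, then the
degrees of the vertices of `A` sum to at most `(2k - 2)|A| + k|B|`, where `B` is the complement
of `A`. -/
theorem sum_degree_le {k : ℕ} (hk : 1 ≤ k) (hA : ∀ x y, H.Adj x y → x ∈ A ∨ y ∈ A)
    (S : Finset V)
    (hS : ∀ l a b, IsPathList H S l → l.head? = some a → l.getLast? = some b → a ∈ A → b ∈ A →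
      l.length < 2 * k) :
    ∑ a ∈ S ∩ A, (S.filter (H.Adj a)).card ≤ (2 * k - 2) * (S ∩ A).card + k * (S \ A).card := by
  induction S using Finset.strongInduction with
  | H S ih =>
    have ih' : ∀ T ⊂ S, ∑ a ∈ T ∩ A, (T.filter (H.Adj a)).card ≤
        (2 * k - 2) * (T ∩ A).card + k * (T \ A).card := fun T hT =>
      ih T hT fun l a b hl => hS l a b (hl.mono hT.1)
    rcases (S ∩ A).eq_empty_or_nonempty with hemp | hne
    · simp [hemp]
    by_cases hdA : ∃ v ∈ S, v ∈ A ∧ (S.filter (H.Adj v)).card < k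
    · obtain ⟨v, hv, hvA, hd⟩ := hdA
      have h1 := ih' _ (Finset.erase_ssubset hv)
      have e1 : S.erase v ∩ A = (S ∩ A).erase v := Finset.erase_inter _ _ _
      have e2 : S.erase v \ A = S \ A := by
        ext x; simp only [Finset.mem_sdiff, Finset.mem_erase]; grind
      have hvSA : v ∈ S ∩ A := Finset.mem_inter.2 ⟨hv, hvA⟩
      have h2 := sum_card_filter_erase (H := H) hv ((S ∩ A).erase v)
      have h3 : (((S ∩ A).erase v).filter (H.Adj v)).card ≤ (S.filter (H.Adj v)).card :=
        Finset.card_le_card (Finset.filter_subset_filter _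
          ((Finset.erase_subset _ _).trans Finset.inter_subset_left))
      have h4 := Finset.card_erase_add_one hvSA
      rw [e1, e2] at h1
      rw [← Finset.add_sum_erase _ _ hvSA, ← h4, mul_add]
      omega
    by_cases hdB : ∃ v ∈ S, v ∉ A ∧ (S.filter (H.Adj v)).card < k + 1
    · obtain ⟨v, hv, hvA, hd⟩ := hdB
      have h1 := ih' _ (Finset.erase_ssubset hv)
      have e1 : S.erase v ∩ A = S ∩ A := by
        ext x; simp only [Finset.mem_inter, Finset.mem_erase]; grind
      have e2 : S.erase v \ A = (S \ A).erase v := by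
        ext x; simp only [Finset.mem_sdiff, Finset.mem_erase]; grind
      have hvSA : v ∈ S \ A := Finset.mem_sdiff.2 ⟨hv, hvA⟩
      have h2 := sum_card_filter_erase (H := H) hv (S ∩ A)
      have h3 : ((S ∩ A).filter (H.Adj v)).card ≤ (S.filter (H.Adj v)).card :=
        Finset.card_le_card (Finset.filter_subset_filter _ Finset.inter_subset_left)
      have h4 := Finset.card_erase_add_one hvSA
      rw [e1, e2] at h1
      rw [← h4, mul_add]
      omega
    push Not at hdA hdB
    obtain ⟨R, hRS, hRne, hRk, hR⟩ := exists_closed_subset hA hS (fun a ha => by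
      by_cases haA : a ∈ A
      · exact hdA a ha haA
      · exact (Nat.le_succ k).trans (hdB a ha haA)) hdB hne
    have h1 := ih' (S \ R) (Finset.sdiff_ssubset hRS hRne)
    have e1 : S ∩ A = (R ∩ A) ∪ (S \ R ∩ A) := by
      ext x
      have := @hRS x
      simp only [Finset.mem_union, Finset.mem_inter, Finset.mem_sdiff]
      tauto
    have hdisj : Disjoint (R ∩ A) (S \ R ∩ A) := by
      rw [Finset.disjoint_left]
      intro x hx hx'
      simp only [Finset.mem_inter, Finset.mem_sdiff] at hx hx'
      exact hx'.1.2 hx.1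
    have h2 : ∑ a ∈ R ∩ A, (S.filter (H.Adj a)).card ≤ (2 * k - 2) * (R ∩ A).card := by
      rw [mul_comm, ← smul_eq_mul]
      refine Finset.sum_le_card_nsmul _ _ _ fun a ha => ?_
      have haR := (Finset.mem_inter.1 ha).1
      have : S.filter (H.Adj a) ⊆ R.erase a := by
        intro y hy
        rw [Finset.mem_filter] at hy
        exact Finset.mem_erase.2 ⟨hy.2.ne', hR a haR y hy.1 hy.2⟩
      have := Finset.card_le_card this
      rw [Finset.card_erase_of_mem haR] at this
      omega
    have h3 : ∑ a ∈ S \ R ∩ A, (S.filter (H.Adj a)).card =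
        ∑ a ∈ S \ R ∩ A, ((S \ R).filter (H.Adj a)).card := by
      refine Finset.sum_congr rfl fun a ha => ?_
      congr 1
      ext y
      simp only [Finset.mem_inter, Finset.mem_sdiff] at ha
      simp only [Finset.mem_filter, Finset.mem_sdiff]
      refine ⟨fun h => ⟨⟨h.1, fun hyR => ha.1.2 (hR y hyR a ha.1.1 h.2.symm)⟩, h.2⟩,
        fun h => ⟨h.1.1, h.2⟩⟩
    have h4 : ((S \ R) \ A).card ≤ (S \ A).card :=
      Finset.card_le_card (Finset.sdiff_subset_sdiff Finset.sdiff_subset le_rfl)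
    have h5 := Nat.mul_le_mul_left k h4
    rw [e1, Finset.sum_union hdisj, Finset.card_union_of_disjoint hdisj, h3, mul_add]
    omega

end ClosedSet

theorem IsPathList.hasPathOn {V : Type*} {G : SimpleGraph V} {S : Finset V} {l : List V} {m : ℕ}
    (hl : IsPathList G S l) (hm : 0 < m) (hml : m ≤ l.length) : HasPathOn G m := by
  have htake : IsPathList G S (l.take m) := by
    rw [← List.take_append_drop m l] at hl
    exact hl.left
  have hne : l.take m ≠ [] := by
    rw [← List.length_pos_iff, List.length_take]
    omega
  refine ⟨_, _, SimpleGraph.Walk.ofSupport _ hne htake.2.1, ?_, ?_⟩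
  · rw [SimpleGraph.Walk.isPath_def, SimpleGraph.Walk.support_ofSupport]
    exact htake.1
  · rw [SimpleGraph.Walk.support_ofSupport, List.length_take]
    omega

theorem degree_le_or_sum_degree_neighbors_le {V : Type*} [Fintype V] [DecidableEq V]
    (G : SimpleGraph V) [DecidableRel G.Adj] {k : ℕ} (hk : 1 ≤ k)
    (hP : ¬ HasPathOn G (2 * k + 2)) (u : V) :
    (∀ v ∈ G.neighborFinset u, G.degree u ≤ 2 * k ∧ G.degree v ≤ 2 * k) ∨
      ∑ v ∈ G.neighborFinset u, G.degree v ≤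
        (2 * k - 1) * G.degree u + k * (Fintype.card V - 1 - G.degree u) := by
  let H : SimpleGraph V :=
    { Adj := fun x y => G.Adj x y ∧ x ≠ u ∧ y ≠ u ∧ (G.Adj u x ∨ G.Adj u y)
      symm := ⟨fun x y h => ⟨h.1.symm, h.2.2.1, h.2.1, h.2.2.2.symm⟩⟩
      loopless := ⟨fun x h => G.loopless.irrefl x h.1⟩ }
  have : DecidableRel H.Adj := fun x y =>
    inferInstanceAs (Decidable (G.Adj x y ∧ x ≠ u ∧ y ≠ u ∧ (G.Adj u x ∨ G.Adj u y)))
  have hno : ∀ l, IsPathList G Finset.univ l → l.length < 2 * k + 2 := by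
    intro l hl
    by_contra hcon
    exact hP (hl.hasPathOn (by omega) (by omega))
  by_cases hlong : ∃ l a b, IsPathList H (Finset.univ.erase u) l ∧ l.head? = some a ∧
      l.getLast? = some b ∧ a ∈ G.neighborFinset u ∧ b ∈ G.neighborFinset u ∧ 2 * k ≤ l.length
  · left
    obtain ⟨l, a, b, hl, ha, hb, hau, hbu, hlen⟩ := hlong
    rw [SimpleGraph.mem_neighborFinset] at hau hbu
    have hlG : IsPathList G Finset.univ l :=
      ⟨hl.1, hl.2.1.imp fun _ _ h => h.1, fun x _ => Finset.mem_univ x⟩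
    have hC : IsPathList G Finset.univ (u :: l) := hlG.cons ha (Finset.mem_univ u)
      (fun h => by simpa using hl.2.2 u h) hau
    have hClen : (u :: l).length = 2 * k + 1 := by
      have := hno _ hC
      simp only [List.length_cons] at this ⊢
      omega
    have hclosed : ∀ c ∈ u :: l, ∀ w, G.Adj c w → w ∈ u :: l := by
      intro c hc w hcw
      by_contra hw
      obtain ⟨t, ht, hp⟩ := hC.exists_rotation (by
        rintro x hx y hy
        rw [List.getLast?_cons, hb] at hx
        simp only [Option.getD_some, Option.mem_def, Option.some.injEq, List.head?_cons] at hx hy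
        subst hx hy
        exact hbu.symm) hc
      have := hno _ (ht.cons rfl (Finset.mem_univ w) (fun h => hw (hp.mem_iff.1 h)) hcw.symm)
      have := hp.length_eq
      simp only [List.length_cons] at *
      omega
    have hdeg : ∀ c ∈ u :: l, G.degree c ≤ 2 * k := by
      intro c hc
      have hsub : G.neighborFinset c ⊆ (u :: l).toFinset.erase c := by
        intro w hw
        rw [SimpleGraph.mem_neighborFinset] at hw
        exact Finset.mem_erase.2 ⟨hw.ne', List.mem_toFinset.2 (hclosed c hc w hw)⟩
      have h1 := Finset.card_le_card hsub
      rw [Finset.card_erase_of_mem (List.mem_toFinset.2 hc),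
        SimpleGraph.card_neighborFinset_eq_degree] at h1
      have h2 := List.toFinset_card_le (u :: l)
      omega
    intro v hv
    rw [SimpleGraph.mem_neighborFinset] at hv
    exact ⟨hdeg u (by simp), hdeg v (hclosed u (by simp) v hv)⟩
  · right
    push Not at hlong
    have key := sum_degree_le (H := H) (A := G.neighborFinset u) hk (fun x y h => by
      simpa [SimpleGraph.mem_neighborFinset] using h.2.2.2) (Finset.univ.erase u) hlong
    have e1 : Finset.univ.erase u ∩ G.neighborFinset u = G.neighborFinset u := by
      rw [Finset.inter_eq_right]
      intro x hx
      rw [SimpleGraph.mem_neighborFinset] at hx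
      exact Finset.mem_erase.2 ⟨hx.ne', Finset.mem_univ x⟩
    have e2 : (Finset.univ.erase u \ G.neighborFinset u).card =
        Fintype.card V - 1 - G.degree u := by
      rw [Finset.card_sdiff, Finset.inter_comm, e1, Finset.card_erase_of_mem (Finset.mem_univ u),
        SimpleGraph.card_neighborFinset_eq_degree, Finset.card_univ]
    have e3 : ∀ v ∈ G.neighborFinset u,
        G.degree v = ((Finset.univ.erase u).filter (H.Adj v)).card + 1 := by
      intro v hv
      rw [SimpleGraph.mem_neighborFinset] at hv
      have : (Finset.univ.erase u).filter (H.Adj v) = (G.neighborFinset v).erase u := by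
        ext y
        simp only [Finset.mem_filter, Finset.mem_erase, Finset.mem_univ, and_true,
          SimpleGraph.mem_neighborFinset]
        exact ⟨fun h => ⟨h.1, h.2.1⟩, fun h => ⟨h.1, h.2, hv.ne', h.1, Or.inl hv⟩⟩
      rw [this, ← SimpleGraph.card_neighborFinset_eq_degree]
      exact (Finset.card_erase_add_one ((G.mem_neighborFinset v u).2 hv.symm)).symm
    rw [e1, e2, SimpleGraph.card_neighborFinset_eq_degree] at key
    rw [Finset.sum_congr rfl e3, Finset.sum_add_distrib, Finset.sum_const,
      SimpleGraph.card_neighborFinset_eq_degree, smul_eq_mul, mul_one]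
    have : (2 * k - 1) * G.degree u = (2 * k - 2) * G.degree u + G.degree u := by
      rw [show 2 * k - 1 = (2 * k - 2) + 1 by omega, add_one_mul]
    omega

theorem deg_eq_degree {V : Type*} [Fintype V] (G : SimpleGraph V) [DecidableRel G.Adj] (v : V) :
    deg G v = G.degree v := by
  rw [deg, Nat.card_eq_fintype_card, SimpleGraph.card_neighborSet_eq_degree]

theorem signlessLaplacian_mulVec {V : Type*} [Fintype V] [DecidableEq V]
    (G : SimpleGraph V) [DecidableRel G.Adj] (x : V → ℝ) (v : V) :
    (signlessLaplacian G).mulVec x v = G.degree v * x v + ∑ w ∈ G.neighborFinset v, x w := by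
  rw [signlessLaplacian, Matrix.add_mulVec, Pi.add_apply, Matrix.mulVec_diagonal, deg_eq_degree,
    SimpleGraph.adjMatrix_mulVec_apply]
  congr!

theorem exists_eigenvector_qIndex {V : Type*} [Fintype V] [DecidableEq V] [Nonempty V]
    (G : SimpleGraph V) :
    ∃ x : V → ℝ, x ≠ 0 ∧ (signlessLaplacian G).mulVec x = qIndex G • x := by
  obtain ⟨i, hi⟩ := exists_eq_ciSup_of_finite
    (f := (signlessLaplacian_isHermitian G).eigenvalues)
  refine ⟨(signlessLaplacian_isHermitian G).eigenvectorBasis i, ?_, ?_⟩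
  · intro h
    refine (signlessLaplacian_isHermitian G).eigenvectorBasis.orthonormal.ne_zero i ?_
    ext j
    exact congrFun h j
  · rw [Matrix.IsHermitian.mulVec_eigenvectorBasis, hi, qIndex]

theorem le_qIndex_of_eigenvector {V : Type*} [Fintype V] [DecidableEq V]
    (G : SimpleGraph V) {x : V → ℝ} {q : ℝ} (hx : x ≠ 0)
    (h : (signlessLaplacian G).mulVec x = q • x) : q ≤ qIndex G := by
  have h1 : Module.End.HasEigenvector (Matrix.toLin' (signlessLaplacian G)) q x := by
    rw [Module.End.hasEigenvector_iff, Module.End.mem_eigenspace_iff]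
    exact ⟨by simpa using h, hx⟩
  have h2 := (Module.End.hasEigenvalue_of_hasEigenvector h1).mem_spectrum
  rw [Matrix.spectrum_toLin',
    (signlessLaplacian_isHermitian G).spectrum_real_eq_range_eigenvalues] at h2
  obtain ⟨i, rfl⟩ := h2
  exact le_ciSup (f := (signlessLaplacian_isHermitian G).eigenvalues)
    (Set.finite_range _).bddAbove i

/-- The `Q`-index is at most the maximum over vertices `u` of the degree of `u` plus the average
degree of its neighbors. -/
theorem qIndex_eq_zero_or_exists_le {V : Type*} [Fintype V] [DecidableEq V] [Nonempty V]
    (G : SimpleGraph V) [DecidableRel G.Adj] :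
    qIndex G = 0 ∨ ∃ u, 0 < G.degree u ∧
      qIndex G * G.degree u ≤
        (G.degree u : ℝ) ^ 2 + ∑ v ∈ G.neighborFinset u, (G.degree v : ℝ) := by
  obtain ⟨x, hx0, hx⟩ := exists_eigenvector_qIndex G
  have hx' : ∀ v, G.degree v * x v + ∑ w ∈ G.neighborFinset v, x w = qIndex G * x v := by
    intro v
    rw [← signlessLaplacian_mulVec, hx, Pi.smul_apply, smul_eq_mul]
  by_cases hall : ∀ v, 0 < G.degree v → x v = 0
  · left
    obtain ⟨v, hv⟩ := Function.ne_iff.1 hx0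
    have hd : G.degree v = 0 := by
      by_contra hd
      exact hv (hall v (Nat.pos_of_ne_zero hd))
    have hN : G.neighborFinset v = ∅ := by
      rw [← Finset.card_eq_zero, SimpleGraph.card_neighborFinset_eq_degree, hd]
    have := hx' v
    rw [hd, hN] at this
    simpa [show x v ≠ 0 from hv] using this
  · right
    push Not at hall
    obtain ⟨v, hv, hxv⟩ := hall
    obtain ⟨u, -, hu⟩ := Finset.exists_max_image Finset.univ (fun w => |x w| / G.degree w)
      ⟨v, Finset.mem_univ v⟩
    set y := |x u| / G.degree u with hy
    have hypos : 0 < y :=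
      lt_of_lt_of_le (div_pos (abs_pos.2 hxv) (by exact_mod_cast hv)) (hu v (Finset.mem_univ v))
    have hdu : 0 < G.degree u := by
      by_contra hcon
      have : G.degree u = 0 := by omega
      simp [hy, this] at hypos
    have hdu' : (0 : ℝ) < G.degree u := by exact_mod_cast hdu
    have hxu : |x u| = y * G.degree u := by
      rw [hy, div_mul_cancel₀ _ hdu'.ne']
    refine ⟨u, hdu, ?_⟩
    have hsum : |∑ w ∈ G.neighborFinset u, x w| ≤
        y * ∑ w ∈ G.neighborFinset u, (G.degree w : ℝ) := by
      rw [Finset.mul_sum]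
      refine (Finset.abs_sum_le_sum_abs _ _).trans (Finset.sum_le_sum fun w hw => ?_)
      have hdw : 0 < G.degree w := by
        rw [G.degree_pos_iff_exists_adj]
        exact ⟨u, ((G.mem_neighborFinset u w).1 hw).symm⟩
      exact (div_le_iff₀ (by exact_mod_cast hdw)).1 (hu w (Finset.mem_univ w))
    have h1 : qIndex G * |x u| ≤ G.degree u * |x u| + |∑ w ∈ G.neighborFinset u, x w| := by
      calc qIndex G * |x u| ≤ |qIndex G| * |x u| :=
            mul_le_mul_of_nonneg_right (le_abs_self _) (abs_nonneg _)
        _ = |G.degree u * x u + ∑ w ∈ G.neighborFinset u, x w| := by rw [hx' u, abs_mul]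
        _ ≤ _ := (abs_add_le _ _).trans (by rw [abs_mul, abs_of_pos hdu'])
    rw [hxu] at h1
    refine le_of_mul_le_mul_left ?_ hypos
    nlinarith

theorem le_qIndex_Snk {n k : ℕ} (hk : 1 ≤ k) (hn : 7 * k ^ 2 < n) :
    (n : ℝ) + 2 * k - 2 - 2 / 7 ≤ qIndex (Snk n k) := by
  classical
  have hkn : k < n := by nlinarith
  have hk' : (1 : ℝ) ≤ k := by exact_mod_cast hk
  have hn' : 7 * (k : ℝ) ^ 2 + 1 ≤ n := by exact_mod_cast hn
  set t : ℝ := n + 2 * k - 2 with ht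
  obtain ⟨q, hq, hqt⟩ : ∃ q : ℝ, q ^ 2 - t * q + 2 * k * (k - 1) = 0 ∧ t - 2 / 7 ≤ q := by
    have hD : (t - 4 / 7) ^ 2 ≤ t ^ 2 - 8 * k * (k - 1) := by nlinarith
    have hD0 := (sq_nonneg _).trans hD
    refine ⟨(t + √(t ^ 2 - 8 * k * (k - 1))) / 2, ?_, ?_⟩
    · have := Real.sq_sqrt hD0
      linear_combination this / 4
    · have := Real.le_sqrt_of_sq_le hD
      linarith
  refine hqt.trans (le_qIndex_of_eigenvector (Snk n k)
    (x := fun v => if (v : ℕ) < k then q - k else k) ?_ ?_)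
  · intro h
    have := congrFun h ⟨k, hkn⟩
    simp at this
    omega
  · have hcard : (Finset.univ.filter fun v : Fin n => (v : ℕ) < k).card = k := by
      rw [Fin.card_filter_val_lt]
      omega
    have hcard' : (Finset.univ.filter fun v : Fin n => ¬ (v : ℕ) < k).card = n - k := by
      have := Finset.card_filter_add_card_filter_not (s := (Finset.univ : Finset (Fin n)))
        (fun v : Fin n => (v : ℕ) < k)
      rw [hcard, Finset.card_univ, Fintype.card_fin] at this
      omega
    funext v
    rw [signlessLaplacian_mulVec, ← SimpleGraph.card_neighborFinset_eq_degree, Pi.smul_apply,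
      smul_eq_mul]
    by_cases hv : (v : ℕ) < k
    · have hN : (Snk n k).neighborFinset v = Finset.univ.erase v := by
        ext w
        rw [SimpleGraph.mem_neighborFinset, Snk, SimpleGraph.fromRel_adj]
        simp [hv, eq_comm]
      have hs : ∑ w : Fin n, (if (w : ℕ) < k then q - k else (k : ℝ)) =
          k * (q - k) + (n - k) * k := by
        rw [Finset.sum_ite, Finset.sum_const, Finset.sum_const, hcard, hcard', nsmul_eq_mul,
          nsmul_eq_mul, Nat.cast_sub hkn.le]
      rw [hN, Finset.card_erase_of_mem (Finset.mem_univ v), Finset.card_univ, Fintype.card_fin,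
        Finset.sum_erase_eq_sub (Finset.mem_univ v), hs, if_pos hv, Nat.cast_sub (by omega)]
      push_cast
      linear_combination -hq
    · have hN : (Snk n k).neighborFinset v = Finset.univ.filter fun w : Fin n => (w : ℕ) < k := by
        ext w
        rw [SimpleGraph.mem_neighborFinset, Snk, SimpleGraph.fromRel_adj]
        simp only [hv, false_or, or_false, Finset.mem_filter, Finset.mem_univ, true_and, or_self]
        refine ⟨fun h => h.2, fun h => ⟨?_, h⟩⟩
        rintro rfl
        exact hv h
      rw [hN, hcard, if_neg hv, Finset.sum_congr rfl fun w hw => if_pos (Finset.mem_filter.1 hw).2,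
        Finset.sum_const, hcard, nsmul_eq_mul]
      ring

/-- If `k ≥ 1`, `n > 7k²`, `q(G) ≥ q(S_{n,k})` and `G` has no path on `2k+2`
vertices, then `G` has a dominating vertex, i.e. `Δ(G) = n - 1`. -/
theorem stmt_3 (k n : ℕ) (hk : 1 ≤ k) (hn : 7 * k ^ 2 < n) (G : SimpleGraph (Fin n))
    (hq : qIndex (Snk n k) ≤ qIndex G) (hP : ¬ HasPathOn G (2 * k + 2)) :
    ∃ u : Fin n, deg G u = n - 1 := by
  classical
  have hn1 : 7 * k ^ 2 + 1 ≤ n := hn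
  have hkk : k ≤ k ^ 2 := Nat.le_self_pow (by norm_num) k
  have : Nonempty (Fin n) := ⟨⟨0, by omega⟩⟩
  have hk' : (1 : ℝ) ≤ k := by exact_mod_cast hk
  have hn' : 7 * (k : ℝ) ^ 2 + 1 ≤ n := by exact_mod_cast hn1
  have hlow := (le_qIndex_Snk hk hn).trans hq
  by_contra! hcon
  have hdeg : ∀ v, G.degree v ≤ n - 2 := by
    intro v
    have h1 := hcon v
    rw [deg_eq_degree] at h1
    have h2 := G.degree_lt_card_verts v
    rw [Fintype.card_fin] at h2
    omega
  have hdeg' : ∀ v, (G.degree v : ℝ) ≤ n - 2 := by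
    intro v
    have := hdeg v
    have : G.degree v + 2 ≤ n := by omega
    have : (G.degree v : ℝ) + 2 ≤ n := by exact_mod_cast this
    linarith
  rcases qIndex_eq_zero_or_exists_le G with h0 | ⟨u, hu, hub⟩
  · rw [h0] at hlow
    nlinarith
  have hu' : (1 : ℝ) ≤ G.degree u := by exact_mod_cast hu
  have hlow' := mul_le_mul_of_nonneg_right hlow (zero_le_one.trans hu')
  by_cases hsmall : G.degree u ≤ k
  · have hs : ∑ v ∈ G.neighborFinset u, (G.degree v : ℝ) ≤ G.degree u * ((n : ℝ) - 2) := by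
      rw [← SimpleGraph.card_neighborFinset_eq_degree, ← nsmul_eq_mul]
      exact Finset.sum_le_card_nsmul _ _ _ fun v _ => hdeg' v
    have hsmall' : (G.degree u : ℝ) ≤ k := by exact_mod_cast hsmall
    nlinarith
  rcases degree_le_or_sum_degree_neighbors_le G hk hP u with h | h
  · obtain ⟨w, hw⟩ := G.degree_pos_iff_exists_adj u |>.1 hu
    have hd : (G.degree u : ℝ) ≤ 2 * k := by
      exact_mod_cast (h w ((G.mem_neighborFinset u w).2 hw)).1
    have hs : ∑ v ∈ G.neighborFinset u, (G.degree v : ℝ) ≤ G.degree u * (2 * k) := by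
      rw [← SimpleGraph.card_neighborFinset_eq_degree, ← nsmul_eq_mul]
      exact Finset.sum_le_card_nsmul _ _ _ fun v hv => by exact_mod_cast (h v hv).2
    have h4 : (G.degree u : ℝ) * (4 * k) < ((n : ℝ) + 2 * k - 2 - 2 / 7) * G.degree u := by
      rw [mul_comm]
      exact mul_lt_mul_of_pos_right (by nlinarith) (by linarith)
    nlinarith
  · have hs : ∑ v ∈ G.neighborFinset u, (G.degree v : ℝ) ≤
        (2 * k - 1) * G.degree u + k * (n - 1 - G.degree u) := by
      have h2 := hdeg u
      have h3 : ((∑ v ∈ G.neighborFinset u, G.degree v : ℕ) : ℝ) ≤ _ := Nat.cast_le.2 h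
      rw [Fintype.card_fin] at h3
      push_cast [Nat.cast_sub (show 1 ≤ 2 * k by omega),
        Nat.cast_sub (show G.degree u ≤ n - 1 by omega), Nat.cast_sub (show 1 ≤ n by omega)] at h3
      exact h3
    have hge : (k : ℝ) + 1 ≤ G.degree u := by exact_mod_cast not_le.1 hsmall
    have := mul_nonneg (sub_nonneg.2 hge) (sub_nonneg.2 (hdeg' u))
    have := hdeg' u
    nlinarith
end

section
/- For k ≥ 2 and n ≥ 7k², one has q(S_{n,k}) > n + 2k − 2 − 2(k² − k)/(n + 2k − 3), and consequently q(S_{n,k}) > n + 2k − 3. -/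
open Matrix BigOperators

theorem deg_eq_sum {V : Type*} [Fintype V] (G : SimpleGraph V) [DecidableRel G.Adj] (v : V) :
    (deg G v : ℝ) = ∑ w, if G.Adj v w then (1 : ℝ) else 0 := by
  rw [deg, Nat.card_eq_fintype_card, G.card_neighborSet_eq_degree, Finset.sum_boole,
    ← G.neighborFinset_eq_filter, G.card_neighborFinset_eq_degree]

theorem signlessLaplacian_mulVec_apply {V : Type*} [Fintype V] [DecidableEq V]
    (G : SimpleGraph V) [DecidableRel G.Adj] (x : V → ℝ) (v : V) :
    (signlessLaplacian G *ᵥ x) v = ∑ w, if G.Adj v w then x v + x w else 0 := by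
  have h : signlessLaplacian G
      = Matrix.diagonal (fun v => (deg G v : ℝ)) + G.adjMatrix ℝ := by
    unfold signlessLaplacian
    congr!
  rw [h, Matrix.add_mulVec, Pi.add_apply, Matrix.mulVec_diagonal, deg_eq_sum, Finset.sum_mul,
    Matrix.mulVec, dotProduct, ← Finset.sum_add_distrib]
  refine Finset.sum_congr rfl fun w _ => ?_
  by_cases hw : G.Adj v w <;> simp [hw]

theorem le_qIndex_of_mulVec_eq {V : Type*} [Fintype V] [DecidableEq V] (G : SimpleGraph V)
    {q : ℝ} {x : V → ℝ} (hx : x ≠ 0) (h : signlessLaplacian G *ᵥ x = q • x) :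
    q ≤ qIndex G := by
  have hq : q ∈ spectrum ℝ (signlessLaplacian G) := by
    rw [← Matrix.spectrum_toLin', ← Module.End.hasEigenvalue_iff_mem_spectrum]
    exact Module.End.hasEigenvalue_of_hasEigenvector
      ⟨Module.End.mem_eigenspace_iff.2 (by simpa using h), hx⟩
  rw [(signlessLaplacian_isHermitian G).spectrum_real_eq_range_eigenvalues] at hq
  obtain ⟨v, rfl⟩ := hq
  exact le_ciSup (Set.finite_range _).bddAbove v

theorem Snk_adj {n k : ℕ} {i j : Fin n} :
    (Snk n k).Adj i j ↔ i ≠ j ∧ ((i : ℕ) < k ∨ (j : ℕ) < k) := by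
  simp only [Snk, SimpleGraph.fromRel_adj]
  tauto

theorem sum_ite_val_lt {n k : ℕ} (hkn : k ≤ n) (a b : ℝ) :
    ∑ j : Fin n, (if (j : ℕ) < k then a else b) = k * a + (n - k) * b := by
  obtain ⟨m, rfl⟩ := Nat.exists_eq_add_of_le hkn
  rw [Fin.sum_univ_add]
  simp

/-- The vector with value `q - k` on the clique and `k` elsewhere is an eigenvector of the signless
Laplacian of `S_{n,k}` for any root `q` of the characteristic polynomial of the quotient matrix. -/
theorem signlessLaplacian_Snk_mulVec {n k : ℕ} (hkn : k ≤ n) {q : ℝ}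
    (hq : q ^ 2 - (n + 2 * k - 2) * q + 2 * (k ^ 2 - k) = 0) :
    signlessLaplacian (Snk n k) *ᵥ (fun i => if (i : ℕ) < k then q - k else k)
      = q • fun i : Fin n => if (i : ℕ) < k then q - k else (k : ℝ) := by
  classical
  ext i
  rw [signlessLaplacian_mulVec_apply, Pi.smul_apply, smul_eq_mul]
  by_cases hi : (i : ℕ) < k
  · have h (j : Fin n) : (if (Snk n k).Adj i j then (if (i : ℕ) < k then q - k else (k : ℝ)) +
        (if (j : ℕ) < k then q - k else (k : ℝ)) else 0) =
        (if (j : ℕ) < k then 2 * (q - k) else q) - if i = j then 2 * (q - k) else 0 := by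
      by_cases hij : i = j
      · subst hij; simp [hi]
      · by_cases hj : (j : ℕ) < k <;> simp [Snk_adj, hi, hj, hij]
        ring
    rw [Finset.sum_congr rfl fun j _ => h j, Finset.sum_sub_distrib, sum_ite_val_lt hkn]
    simp only [Finset.sum_ite_eq, Finset.mem_univ, if_true, hi]
    linear_combination -hq
  · have h (j : Fin n) : (if (Snk n k).Adj i j then (if (i : ℕ) < k then q - k else (k : ℝ)) +
        (if (j : ℕ) < k then q - k else (k : ℝ)) else 0) = if (j : ℕ) < k then q else 0 := by
      by_cases hj : (j : ℕ) < k
      · have hij : i ≠ j := by rintro rfl; exact hi hj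
        simp [Snk_adj, hi, hj, hij]
      · simp [Snk_adj, hi, hj]
    rw [Finset.sum_congr rfl fun j _ => h j, sum_ite_val_lt hkn]
    simp only [hi, if_false]
    ring

/-- For `k ≥ 2` and `n ≥ 7k²`, `q(S_{n,k}) > n + 2k - 2 - 2(k² - k)/(n + 2k - 3)`,
and consequently `q(S_{n,k}) > n + 2k - 3`. -/
theorem stmt_8 (k n : ℕ) (hk : 2 ≤ k) (hn : 7 * k ^ 2 ≤ n) :
    (n : ℝ) + 2 * k - 2 - 2 * ((k : ℝ) ^ 2 - k) / ((n : ℝ) + 2 * k - 3) < qIndex (Snk n k) ∧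
    (n : ℝ) + 2 * k - 3 < qIndex (Snk n k) := by
  have hkn : k ≤ n := by nlinarith
  have hk' : (2 : ℝ) ≤ k := by exact_mod_cast hk
  have hn' : 7 * (k : ℝ) ^ 2 ≤ n := by exact_mod_cast hn
  set c : ℝ := (k : ℝ) ^ 2 - k with hc
  set b : ℝ := (n : ℝ) + 2 * k - 3 with hb
  have hc0 : 0 < c := by nlinarith
  have hcb : 2 * c < b := by nlinarith
  have hb0 : 0 < b := by linarith
  obtain ⟨q, hq, hbq⟩ : ∃ q : ℝ, q ^ 2 - (b + 1) * q + 2 * c = 0 ∧ b < q := by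
    have hD : (b - 1) ^ 2 < (b + 1) ^ 2 - 8 * c := by nlinarith
    have hlt := Real.lt_sqrt_of_sq_lt hD
    have hsq := Real.sq_sqrt ((sq_nonneg (b - 1)).trans hD.le)
    refine ⟨(b + 1 + √((b + 1) ^ 2 - 8 * c)) / 2, ?_, by linarith⟩
    linear_combination hsq / 4
  have hle : q ≤ qIndex (Snk n k) := by
    have hi : k < n := by nlinarith
    refine le_qIndex_of_mulVec_eq _ (fun h => ?_)
      (signlessLaplacian_Snk_mulVec hkn (by rw [← hq, hb, hc]; ring))
    have := congrFun h ⟨k, hi⟩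
    simp at this
    omega
  refine ⟨lt_of_lt_of_le ?_ hle, hbq.trans_le hle⟩
  have hq0 : 0 < q := hb0.trans hbq
  have hdiv : 2 * c / q < 2 * c / b := div_lt_div_of_pos_left (by positivity) hb0 hbq
  have hqe : q = b + 1 - 2 * c / q := by
    field_simp
    linear_combination hq
  linarith
end
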